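/- Let (ρ, u, b) be a classical solution on [0,T) × ℝ² of the 2D magnetohydrodynamic system ∂_t ρ + ∇·(ρu) = 0, ∂_t(ρu) + ∇·(ρ u⊗u) + (1/2)∇(ρ² + b²) = 0, (∂_t + u·∇)(b/ρ) = 0, with b₀ a constant, such that for each t, ρ(t,·) − 1, u(t,·), and b(t,·) − b₀ are compactly supported. Then Y(t) = ∫_{ℝ²}∫_{S¹} e^{ω·x} ρ(t,x)(u(t,x)·ω) dσ(ω) dx is differentiable with Y'(t) = ∫_{ℝ²}∫_{S¹} e^{ω·x} ρ(t,x)(u(t,x)·ω)² dσ(ω) dx + (1/2)∫_{ℝ²}∫_{S¹} e^{ω·x} (b(t,x)² + ρ(t,x)² − b₀² − 1) dσ(ω) dx for all t ∈ [0,T). -/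

import Mathlib

open MeasureTheory Real Set Metric
open scoped ENNReal RealInnerProductSpace

noncomputable section

/-- `ℝ²` as a Euclidean space. -/
abbrev E2 : Type := EuclideanSpace ℝ (Fin 2)

/-- The arclength measure on the unit circle `S¹ ⊆ ℝ²`. -/
def sphμ : Measure (sphere (0 : E2) 1) := (volume : Measure E2).toSphere

/-- The spatial partial derivative `∂ᵢ f`. -/
def pdv (i : Fin 2) (f : E2 → ℝ) (x : E2) : ℝ := fderiv ℝ f x (EuclideanSpace.single i 1)

/-- The time interval `[0, T)` for an extended-real final time `T ∈ (0, ∞]`. -/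
def timeSet (T : ℝ≥0∞) : Set ℝ := {t : ℝ | 0 ≤ t ∧ ENNReal.ofReal t < T}

/-- `(ρ, u, b)` is a classical solution on `[0,T) × ℝ²` of the 2D MHD system with vertical
magnetic field and pressure `p(ρ) = ρ²/2`:
`∂ₜρ + ∇·(ρu) = 0`, `∂ₜ(ρu) + ∇·(ρu⊗u) + ½∇(ρ²+b²) = 0`, `(∂ₜ + u·∇)(b/ρ) = 0`. -/
structure IsMHDSolution (T : ℝ≥0∞) (ρ : ℝ → E2 → ℝ) (u : ℝ → E2 → E2) (b : ℝ → E2 → ℝ) :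
    Prop where
  contDiff_rho : ContDiffOn ℝ 1 (fun p : ℝ × E2 => ρ p.1 p.2) (timeSet T ×ˢ univ)
  contDiff_u : ContDiffOn ℝ 1 (fun p : ℝ × E2 => u p.1 p.2) (timeSet T ×ˢ univ)
  contDiff_b : ContDiffOn ℝ 1 (fun p : ℝ × E2 => b p.1 p.2) (timeSet T ×ˢ univ)
  rho_pos : ∀ t ∈ timeSet T, ∀ x, 0 < ρ t x
  mass : ∀ t ∈ timeSet T, ∀ x : E2,
    derivWithin (fun s => ρ s x) (timeSet T) t
      + ∑ i, pdv i (fun y => ρ t y * u t y i) x = 0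
  momentum : ∀ t ∈ timeSet T, ∀ x : E2, ∀ j : Fin 2,
    derivWithin (fun s => ρ s x * u s x j) (timeSet T) t
      + ∑ i, pdv i (fun y => ρ t y * u t y i * u t y j) x
      + pdv j (fun y => (ρ t y ^ 2 + b t y ^ 2) / 2) x = 0
  transport : ∀ t ∈ timeSet T, ∀ x : E2,
    derivWithin (fun s => b s x / ρ s x) (timeSet T) t
      + ∑ i, u t x i * pdv i (fun y => b t y / ρ t y) x = 0


theorem timeSet_convex (T : ℝ≥0∞) : Convex ℝ (timeSet T) := by
  apply Set.OrdConnected.convex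
  constructor
  rintro a ⟨ha, ha'⟩ c ⟨hc, hc'⟩ z ⟨hz, hz'⟩
  exact ⟨ha.trans hz, (ENNReal.ofReal_le_ofReal hz').trans_lt hc'⟩

theorem timeSet_Icc {T : ℝ≥0∞} {t : ℝ} (ht : t ∈ timeSet T) : Icc 0 t ⊆ timeSet T := by
  rintro z ⟨hz, hz'⟩
  exact ⟨hz, (ENNReal.ofReal_le_ofReal hz').trans_lt ht.2⟩

theorem timeSet_exists_gt {T : ℝ≥0∞} {t : ℝ} (ht : t ∈ timeSet T) : ∃ t₁ ∈ timeSet T, t < t₁ := by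
  obtain ⟨r, hr, hr'⟩ := ENNReal.lt_iff_exists_nnreal_btwn.1 ht.2
  refine ⟨r, ⟨r.2, ?_⟩, ?_⟩
  · simpa using hr'
  · rw [← ENNReal.ofReal_coe_nnreal] at hr
    exact (ENNReal.ofReal_lt_ofReal_iff_of_nonneg ht.1).1 hr

theorem timeSet_nhds {T : ℝ≥0∞} {t : ℝ} (ht : t ∈ timeSet T) (h0 : 0 < t) :
    timeSet T ∈ nhds t := by
  obtain ⟨t₁, h₁, h⟩ := timeSet_exists_gt ht
  exact Filter.mem_of_superset (Icc_mem_nhds h0 h) (timeSet_Icc h₁)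

theorem timeSet_uniqueDiffOn (T : ℝ≥0∞) : UniqueDiffOn ℝ (timeSet T) := by
  intro t ht
  obtain ⟨t₁, h₁, h⟩ := timeSet_exists_gt ht
  have hlt : (0:ℝ) < t₁ := ht.1.trans_lt h
  exact (uniqueDiffOn_Icc hlt t ⟨ht.1, h.le⟩).mono (timeSet_Icc h₁)

theorem cyl_uniqueDiffOn (T : ℝ≥0∞) : UniqueDiffOn ℝ (timeSet T ×ˢ (univ : Set E2)) :=
  (timeSet_uniqueDiffOn T).prod uniqueDiffOn_univ

/-- Continuously differentiable on the space-time cylinder. -/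
def C1 (T : ℝ≥0∞) (f : ℝ → E2 → ℝ) : Prop :=
  ContDiffOn ℝ 1 (fun p : ℝ × E2 => f p.1 p.2) (timeSet T ×ˢ univ)

/-- The time derivative. -/
def dt (T : ℝ≥0∞) (f : ℝ → E2 → ℝ) (t : ℝ) (x : E2) : ℝ :=
  derivWithin (fun s => f s x) (timeSet T) t

theorem C1.contDiff {T : ℝ≥0∞} {f : ℝ → E2 → ℝ} (hf : C1 T f) {t : ℝ} (ht : t ∈ timeSet T) :
    ContDiff ℝ 1 (f t) := by
  rw [← contDiffOn_univ]
  exact ContDiffOn.comp (g := fun p : ℝ × E2 => f p.1 p.2) hf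
    (contDiff_const.prodMk contDiff_id).contDiffOn (fun x _ => ⟨ht, mem_univ _⟩)

theorem C1.hasFDerivAt {T : ℝ≥0∞} {f : ℝ → E2 → ℝ} (hf : C1 T f) {t : ℝ} (ht : t ∈ timeSet T)
    (x : E2) : HasFDerivAt (f t) (fderiv ℝ (f t) x) x :=
  ((hf.contDiff ht).differentiable one_ne_zero x).hasFDerivAt

theorem C1.hasDeriv' {T : ℝ≥0∞} {f : ℝ → E2 → ℝ} (hf : C1 T f) {t : ℝ} (ht : t ∈ timeSet T)
    (x : E2) : HasDerivWithinAt (fun s => f s x)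
      (fderivWithin ℝ (fun p : ℝ × E2 => f p.1 p.2) (timeSet T ×ˢ univ) (t, x) (1, 0))
      (timeSet T) t := by
  have h1 : HasFDerivWithinAt (fun p : ℝ × E2 => f p.1 p.2) _ (timeSet T ×ˢ univ) (t, x) :=
    (hf.differentiableOn one_ne_zero (t, x) ⟨ht, mem_univ _⟩).hasFDerivWithinAt
  have h2 : HasDerivWithinAt (fun s : ℝ => (s, x)) ((1 : ℝ), (0 : E2)) (timeSet T) t :=
    ((hasDerivAt_id t).prodMk (hasDerivAt_const t x)).hasDerivWithinAt
  exact h1.comp_hasDerivWithinAt t h2 (fun s hs => mk_mem_prod hs (mem_univ _))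

theorem C1.dt_eq {T : ℝ≥0∞} {f : ℝ → E2 → ℝ} (hf : C1 T f) {t : ℝ} (ht : t ∈ timeSet T)
    (x : E2) : dt T f t x =
      fderivWithin ℝ (fun p : ℝ × E2 => f p.1 p.2) (timeSet T ×ˢ univ) (t, x) (1, 0) :=
  (hf.hasDeriv' ht x).derivWithin (timeSet_uniqueDiffOn T t ht)

theorem C1.hasDeriv {T : ℝ≥0∞} {f : ℝ → E2 → ℝ} (hf : C1 T f) {t : ℝ} (ht : t ∈ timeSet T)
    (x : E2) : HasDerivWithinAt (fun s => f s x) (dt T f t x) (timeSet T) t := by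
  rw [hf.dt_eq ht]; exact hf.hasDeriv' ht x

theorem dt_of {T : ℝ≥0∞} {f : ℝ → E2 → ℝ} {t : ℝ} {x : E2} {d : ℝ} (ht : t ∈ timeSet T)
    (h : HasDerivWithinAt (fun s => f s x) d (timeSet T) t) : dt T f t x = d :=
  h.derivWithin (timeSet_uniqueDiffOn T t ht)

theorem pdv_of {i : Fin 2} {f : E2 → ℝ} {x : E2} {L : E2 →L[ℝ] ℝ} (h : HasFDerivAt f L x) :
    pdv i f x = L (EuclideanSpace.single i 1) := by
  rw [pdv, h.fderiv]

theorem C1.dt_cont {T : ℝ≥0∞} {f : ℝ → E2 → ℝ} (hf : C1 T f) :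
    ContinuousOn (fun p : ℝ × E2 => dt T f p.1 p.2) (timeSet T ×ˢ univ) := by
  have h := ContDiffOn.continuousOn_fderivWithin hf (cyl_uniqueDiffOn T) le_rfl
  have h2 := h.clm_apply (continuousOn_const (c := ((1 : ℝ), (0 : E2))))
  refine h2.congr ?_
  rintro ⟨t, x⟩ ⟨ht, -⟩
  exact hf.dt_eq ht x

open Filter Topology in
theorem hasDeriv_integral {T : ℝ≥0∞} {f : ℝ → E2 → ℝ} (hf : C1 T f) {t t₁ : ℝ}
    (ht : t ∈ timeSet T) (ht₁ : t₁ ∈ timeSet T) (hlt : t < t₁) {K : Set E2} (hK : IsCompact K)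
    (hz : ∀ s ∈ timeSet T, s ≤ t₁ → ∀ x ∉ K, f s x = 0) :
    HasDerivWithinAt (fun s => ∫ x, f s x) (∫ x, dt T f t x) (timeSet T) t := by
  have hcomp : IsCompact (Icc 0 t₁ ×ˢ K) := isCompact_Icc.prod hK
  obtain ⟨C, hC⟩ := hcomp.exists_bound_of_continuousOn
    (hf.dt_cont.mono (prod_mono (timeSet_Icc ht₁) (subset_univ _)))
  have hInt : ∀ s ∈ timeSet T, s ≤ t₁ → Integrable (f s) := fun s hs hs1 =>
    (hf.contDiff hs).continuous.integrable_of_hasCompactSupport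
      (HasCompactSupport.intro hK (hz s hs hs1))
  rw [hasDerivWithinAt_iff_tendsto_slope]
  have hev : ∀ᶠ s in 𝓝[timeSet T \ {t}] t, s ∈ timeSet T ∧ s ≠ t ∧ s ≤ t₁ := by
    have h1 : ∀ᶠ s in 𝓝[timeSet T \ {t}] t, s ∈ timeSet T \ {t} := self_mem_nhdsWithin
    have h2 : ∀ᶠ s in 𝓝[timeSet T \ {t}] t, s < t₁ :=
      nhdsWithin_le_nhds (eventually_lt_nhds hlt)
    filter_upwards [h1, h2] with s hs hs2
    exact ⟨hs.1, hs.2, hs2.le⟩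
  have key : Tendsto (fun s => ∫ x, slope (fun s => f s x) t s) (𝓝[timeSet T \ {t}] t)
      (𝓝 (∫ x, dt T f t x)) := by
    refine tendsto_integral_filter_of_dominated_convergence (K.indicator (fun _ => C)) ?_ ?_ ?_ ?_
    · filter_upwards [hev] with s hs
      have : Continuous (fun x => slope (fun s => f s x) t s) := by
        simp only [slope_def_field]
        exact ((hf.contDiff hs.1).continuous.sub (hf.contDiff ht).continuous).div_const _
      exact this.aestronglyMeasurable
    · filter_upwards [hev] with s hs
      refine Eventually.of_forall fun x => ?_
      by_cases hx : x ∈ K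
      · rw [indicator_of_mem hx]
        have hd : ∀ z ∈ Icc 0 t₁, HasDerivWithinAt (fun s => f s x) (dt T f z x) (Icc 0 t₁) z :=
          fun z hz' => (hf.hasDeriv (timeSet_Icc ht₁ hz') x).mono (timeSet_Icc ht₁)
        have := (convex_Icc (0:ℝ) t₁).norm_image_sub_le_of_norm_hasDerivWithin_le hd
          (fun z hz' => hC (z, x) ⟨hz', hx⟩) ⟨ht.1, hlt.le⟩ ⟨hs.1.1, hs.2.2⟩
        rw [slope_def_field, norm_div, div_le_iff₀ (norm_pos_iff.2 (sub_ne_zero.2 hs.2.1))]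
        exact this
      · rw [indicator_of_notMem hx, slope_def_field, hz s hs.1 hs.2.2 x hx, hz t ht hlt.le x hx]
        simp
    · rw [integrable_indicator_iff hK.measurableSet]
      exact integrableOn_const hK.measure_lt_top.ne
    · exact Eventually.of_forall fun x => hasDerivWithinAt_iff_tendsto_slope.1 (hf.hasDeriv ht x)
  refine key.congr' ?_
  filter_upwards [hev] with s hs
  simp only [slope_def_field]
  rw [integral_div, integral_sub (hInt s hs.1 hs.2.2) (hInt t ht hlt.le)]

theorem pdv_continuous {i : Fin 2} {f : E2 → ℝ} (hf : ContDiff ℝ 1 f) : Continuous (pdv i f) :=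
  (hf.continuous_fderiv one_ne_zero).clm_apply continuous_const

theorem pdv_hcs {i : Fin 2} {f : E2 → ℝ} (hf : HasCompactSupport f) :
    HasCompactSupport (pdv i f) :=
  hf.fderiv_apply (𝕜 := ℝ) _

theorem ibp {i : Fin 2} {f g : E2 → ℝ} (hf : ContDiff ℝ 1 f) (hg : ContDiff ℝ 1 g)
    (hc : HasCompactSupport g) : ∫ x, f x * pdv i g x = - ∫ x, pdv i f x * g x := by
  refine integral_mul_fderiv_eq_neg_fderiv_mul_of_integrable ?_ ?_ ?_
    (fun x _ => hf.differentiable one_ne_zero x) (fun x _ => hg.differentiable one_ne_zero x)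
  · exact ((pdv_continuous (i := i) hf).mul hg.continuous).integrable_of_hasCompactSupport hc.mul_left
  · exact (hf.continuous.mul (pdv_continuous (i := i) hg)).integrable_of_hasCompactSupport
      (pdv_hcs hc).mul_left
  · exact (hf.continuous.mul hg.continuous).integrable_of_hasCompactSupport hc.mul_left

/-- The spherical weights. -/
def G (m : sphere (0 : E2) 1 → ℝ) (x : E2) : ℝ := ∫ ω : sphere (0 : E2) 1, exp ⟪(ω : E2), x⟫ * m ω ∂sphμ

instance : IsFiniteMeasure sphμ := by unfold sphμ; infer_instance

theorem sph_integrable {f : sphere (0 : E2) 1 → ℝ} (hf : Continuous f) : Integrable f sphμ :=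
  hf.integrable_of_hasCompactSupport (HasCompactSupport.of_compactSpace f)

theorem G_hasFDerivAt {m : sphere (0 : E2) 1 → ℝ} (hm : Continuous m) (x : E2) :
    HasFDerivAt (G m) (∫ ω : sphere (0 : E2) 1, (exp ⟪(ω : E2), x⟫ * m ω) • innerSL ℝ (ω : E2) ∂sphμ) x := by
  obtain ⟨C, hC⟩ := (isCompact_univ (X := sphere (0 : E2) 1)).exists_bound_of_continuousOn hm.continuousOn
  have hC' : ∀ ω, ‖m ω‖ ≤ C := fun ω => hC ω (mem_univ _)
  refine hasFDerivAt_integral_of_dominated_of_fderiv_le (𝕜 := ℝ)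
    (F := fun (x : E2) (ω : sphere (0 : E2) 1) => exp ⟪(ω : E2), x⟫ * m ω)
    (F' := fun (x : E2) (ω : sphere (0 : E2) 1) => (exp ⟪(ω : E2), x⟫ * m ω) • innerSL ℝ (ω : E2))
    (s := ball x 1) (bound := fun _ => exp (‖x‖ + 1) * C)
    (ball_mem_nhds x one_pos) ?_ ?_ ?_ ?_ ?_ ?_
  · refine Filter.Eventually.of_forall fun y => ?_
    have : Continuous (fun ω : sphere (0 : E2) 1 => exp ⟪(ω : E2), y⟫ * m ω) := by fun_prop
    exact this.aestronglyMeasurable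
  · apply sph_integrable; fun_prop
  · have : Continuous (fun ω : sphere (0 : E2) 1 => (exp ⟪(ω : E2), x⟫ * m ω) • innerSL ℝ (ω : E2)) := by
      fun_prop
    exact this.aestronglyMeasurable
  · refine Filter.Eventually.of_forall fun ω y hy => ?_
    have h1 : ‖(ω : E2)‖ = 1 := by simp
    rw [norm_smul, innerSL_apply_norm, h1, mul_one, norm_mul, Real.norm_eq_abs, abs_exp]
    have h2 : ⟪(ω : E2), y⟫ ≤ ‖x‖ + 1 := by
      have a := real_inner_le_norm (ω : E2) y
      have b : ‖y‖ ≤ ‖x‖ + 1 := by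
        have := norm_sub_norm_le y x
        have h3 : ‖y - x‖ < 1 := by simpa [dist_eq_norm] using hy
        linarith
      rw [h1, one_mul] at a
      linarith
    exact mul_le_mul (exp_le_exp.2 h2) (hC' ω) (norm_nonneg _) (exp_pos _).le
  · exact integrable_const _
  · refine Filter.Eventually.of_forall fun ω y _ => ?_
    have h1 : HasFDerivAt (fun y : E2 => ⟪(ω : E2), y⟫) (innerSL ℝ (ω : E2)) y :=
      (innerSL ℝ (ω : E2)).hasFDerivAt
    have h2 := (h1.exp).mul_const (m ω)
    refine h2.congr_fderiv ?_
    rw [smul_smul, mul_comm]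

theorem G_contDiff {m : sphere (0 : E2) 1 → ℝ} (hm : Continuous m) : ContDiff ℝ 1 (G m) := by
  rw [contDiff_one_iff_fderiv]
  refine ⟨fun x => (G_hasFDerivAt hm x).differentiableAt, ?_⟩
  rw [show fderiv ℝ (G m) = _ from funext fun x => (G_hasFDerivAt hm x).fderiv]
  have := continuous_parametric_integral_of_continuous (μ := sphμ) (s := univ)
    (f := fun (x : E2) (ω : sphere (0 : E2) 1) => (exp ⟪(ω : E2), x⟫ * m ω) • innerSL ℝ (ω : E2))
    (by simp only [Function.uncurry_def]; fun_prop) isCompact_univ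
  simpa using this

theorem G_pdv {m : sphere (0 : E2) 1 → ℝ} (hm : Continuous m) (i : Fin 2) (x : E2) :
    pdv i (G m) x = G (fun ω => m ω * (ω : E2) i) x := by
  rw [pdv_of (G_hasFDerivAt hm x), ContinuousLinearMap.integral_apply]
  · simp [G, EuclideanSpace.inner_single_right, mul_assoc]
  · have : Continuous (fun ω : sphere (0 : E2) 1 => (exp ⟪(ω : E2), x⟫ * m ω) • innerSL ℝ (ω : E2)) := by
      fun_prop
    exact this.integrable_of_hasCompactSupport (HasCompactSupport.of_compactSpace _)

section PW
variable {T : ℝ≥0∞} {ρ : ℝ → E2 → ℝ} {u : ℝ → E2 → E2} {b : ℝ → E2 → ℝ}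

theorem IsMHDSolution.c1u (hsol : IsMHDSolution T ρ u b) (j : Fin 2) :
    C1 T (fun t x => u t x j) :=
  ((EuclideanSpace.proj j : E2 →L[ℝ] ℝ).contDiff).comp_contDiffOn hsol.contDiff_u

/-- The relative energy. -/
def eta (b₀ : ℝ) (ρ : ℝ → E2 → ℝ) (u : ℝ → E2 → E2) (b : ℝ → E2 → ℝ) (t : ℝ) (x : E2) : ℝ :=
  ρ t x * (u t x 0 ^ 2 + u t x 1 ^ 2) / 2 + (ρ t x - 1) ^ 2 / 2 + (b t x - b₀) ^ 2 / 2

/-- The relative energy flux. -/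
def qq (b₀ : ℝ) (ρ : ℝ → E2 → ℝ) (u : ℝ → E2 → E2) (b : ℝ → E2 → ℝ) (i : Fin 2) (t : ℝ) (x : E2) : ℝ :=
  u t x i * (ρ t x * (u t x 0 ^ 2 + u t x 1 ^ 2) / 2 + ρ t x * (ρ t x - 1) + b t x * (b t x - b₀))

theorem eta_c1 (b₀ : ℝ) (hsol : IsMHDSolution T ρ u b) : C1 T (eta b₀ ρ u b) := by
  have h0 := hsol.c1u 0
  have h1 := hsol.c1u 1
  have hr := hsol.contDiff_rho
  have hb := hsol.contDiff_b
  unfold C1 at *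
  unfold eta
  fun_prop

theorem qq_c1 (b₀ : ℝ) (hsol : IsMHDSolution T ρ u b) (i : Fin 2) : C1 T (qq b₀ ρ u b i) := by
  have h0 := hsol.c1u 0
  have h1 := hsol.c1u 1
  have hi := hsol.c1u i
  have hr := hsol.contDiff_rho
  have hb := hsol.contDiff_b
  unfold C1 at *
  unfold qq
  fun_prop

theorem eta_cons (b₀ : ℝ) (hsol : IsMHDSolution T ρ u b) {t : ℝ} (ht : t ∈ timeSet T) (x : E2) :
    dt T (eta b₀ ρ u b) t x = -(pdv 0 (qq b₀ ρ u b 0 t) x + pdv 1 (qq b₀ ρ u b 1 t) x) := by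
  have hpos : ρ t x ≠ 0 := (hsol.rho_pos t ht x).ne'
  have cr : C1 T ρ := hsol.contDiff_rho
  have cb : C1 T b := hsol.contDiff_b
  have tr := cr.hasDeriv ht x
  have tb := cb.hasDeriv ht x
  have t0 := (hsol.c1u 0).hasDeriv ht x
  have t1 := (hsol.c1u 1).hasDeriv ht x
  have xr := cr.hasFDerivAt ht x
  have xb := cb.hasFDerivAt ht x
  have x0 := (hsol.c1u 0).hasFDerivAt ht x
  have x1 := (hsol.c1u 1).hasFDerivAt ht x
  have hmass := hsol.mass t ht x
  have hm0 := hsol.momentum t ht x 0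
  have hm1 := hsol.momentum t ht x 1
  have htr := hsol.transport t ht x
  change dt T ρ t x + _ = 0 at hmass
  change dt T (fun s x => ρ s x * u s x 0) t x + _ + _ = 0 at hm0
  change dt T (fun s x => ρ s x * u s x 1) t x + _ + _ = 0 at hm1
  change dt T (fun s x => b s x / ρ s x) t x + _ = 0 at htr
  have hx : ∀ j : Fin 2, HasFDerivAt (fun y => u t y j) (fderiv ℝ (fun y => u t y j) x) x := fun j =>
    (hsol.c1u j).hasFDerivAt ht x
  rw [Fin.sum_univ_two, pdv_of (f := fun y => ρ t y * u t y 0) (xr.mul x0), pdv_of (f := fun y => ρ t y * u t y 1) (xr.mul x1)] at hmass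
  rw [Fin.sum_univ_two, dt_of (f := fun s x => ρ s x * u s x 0) ht (tr.mul t0),
    pdv_of (f := fun y => ρ t y * u t y 0 * u t y 0) ((xr.mul x0).mul x0), pdv_of (f := fun y => ρ t y * u t y 1 * u t y 0) ((xr.mul x1).mul x0),
    pdv_of (f := fun y => (ρ t y ^ 2 + b t y ^ 2) / 2) (((xr.pow 2).add (xb.pow 2)).mul_const (2:ℝ)⁻¹)] at hm0
  rw [Fin.sum_univ_two, dt_of (f := fun s x => ρ s x * u s x 1) ht (tr.mul t1),
    pdv_of (f := fun y => ρ t y * u t y 0 * u t y 1) ((xr.mul x0).mul x1), pdv_of (f := fun y => ρ t y * u t y 1 * u t y 1) ((xr.mul x1).mul x1),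
    pdv_of (f := fun y => (ρ t y ^ 2 + b t y ^ 2) / 2) (((xr.pow 2).add (xb.pow 2)).mul_const (2:ℝ)⁻¹)] at hm1
  rw [Fin.sum_univ_two, dt_of (f := fun s x => b s x / ρ s x) ht (tb.div tr hpos),
    pdv_of (f := fun y => b t y / ρ t y) (xb.mul ((hasDerivAt_inv hpos).comp_hasFDerivAt x xr)), pdv_of (f := fun y => b t y / ρ t y) (xb.mul ((hasDerivAt_inv hpos).comp_hasFDerivAt x xr))] at htr
  have he := dt_of (f := eta b₀ ρ u b) ht
    (((((tr.mul ((t0.pow 2).add (t1.pow 2))).mul_const (2:ℝ)⁻¹)).add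
      (((tr.sub_const 1).pow 2).mul_const (2:ℝ)⁻¹)).add (((tb.sub_const b₀).pow 2).mul_const (2:ℝ)⁻¹))
  have hg := ((((xr.mul ((x0.pow 2).add (x1.pow 2))).mul_const (2:ℝ)⁻¹)).add
      (xr.mul (xr.sub_const 1))).add (xb.mul (xb.sub_const b₀))
  have hq0 := pdv_of (i := 0) (x0.mul hg)
  have hq1 := pdv_of (i := 1) (x1.mul hg)
  have e0 : pdv 0 (qq b₀ ρ u b 0 t) x = _ := hq0
  have e1 : pdv 1 (qq b₀ ρ u b 1 t) x = _ := hq1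
  rw [he, e0, e1]
  clear he hq0 hq1 hg e0 e1 hx
  simp only [add_apply, smul_apply, smul_eq_mul,
    nsmul_eq_mul, Pi.add_apply, Pi.mul_apply, Pi.pow_apply] at *
  have hb : dt T b t x + b t x * ((fderiv ℝ (fun x => u t x 0) x) (EuclideanSpace.single 0 1)
      + (fderiv ℝ (fun x => u t x 1) x) (EuclideanSpace.single 1 1))
      + u t x 0 * fderiv ℝ (b t) x (EuclideanSpace.single 0 1)
      + u t x 1 * fderiv ℝ (b t) x (EuclideanSpace.single 1 1) = 0 := by
    field_simp at htr
    have : ρ t x * (dt T b t x + b t x * ((fderiv ℝ (fun x => u t x 0) x) (EuclideanSpace.single 0 1)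
      + (fderiv ℝ (fun x => u t x 1) x) (EuclideanSpace.single 1 1))
      + u t x 0 * fderiv ℝ (b t) x (EuclideanSpace.single 0 1)
      + u t x 1 * fderiv ℝ (b t) x (EuclideanSpace.single 1 1)) = 0 := by
      linear_combination htr + b t x * hmass
    exact (mul_eq_zero.1 this).resolve_left hpos
  push_cast
  linear_combination u t x 0 * hm0 + u t x 1 * hm1
    + (ρ t x - 1 - (u t x 0 ^ 2 + u t x 1 ^ 2) / 2) * hmass + (b t x - b₀) * hb

theorem qbound {R U W B b₀ v w : ℝ} (h1 : 1 / 2 ≤ R) (h2 : R ≤ 2) (h3 : U ^ 2 + W ^ 2 ≤ 1)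
    (h4 : |B| ≤ |b₀| + 1) (h5 : v ^ 2 + w ^ 2 ≤ 1) :
    |(v * U + w * W) * (R * (U ^ 2 + W ^ 2) / 2 + R * (R - 1) + B * (B - b₀))| ≤
      (7 + 2 * |b₀|) * (R * (U ^ 2 + W ^ 2) / 2 + (R - 1) ^ 2 / 2 + (B - b₀) ^ 2 / 2) := by
  set n := U ^ 2 + W ^ 2 with hn
  have hn0 : 0 ≤ n := by positivity
  set a := v * U + w * W with ha
  have han : a ^ 2 ≤ n := by
    have : a ^ 2 ≤ (v ^ 2 + w ^ 2) * n := by rw [ha, hn]; nlinarith [sq_nonneg (v * W - w * U)]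
    nlinarith
  have ha1 : |a| ≤ 1 := by
    rw [← sq_le_one_iff_abs_le_one]; linarith
  have hRn : n ≤ 4 * (R * n / 2) := by nlinarith
  have hb0 := abs_nonneg b₀
  set M := |b₀| + 1 with hM
  have hM0 : 0 ≤ M := by positivity
  have e1 : |a * (R * n / 2)| ≤ R * n / 2 := by
    have : 0 ≤ R * n / 2 := by positivity
    rw [abs_mul, abs_of_nonneg this]
    nlinarith
  have e2 : |a * (R * (R - 1))| ≤ a ^ 2 + (R - 1) ^ 2 := by
    rw [abs_mul, abs_mul, abs_of_nonneg (by linarith : 0 ≤ R)]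
    have := mul_nonneg (abs_nonneg a) (abs_nonneg (R - 1))
    nlinarith [sq_nonneg (|a| - |R - 1|), sq_abs a, sq_abs (R - 1)]
  have e3 : |a * (B * (B - b₀))| ≤ M * ((a ^ 2 + (B - b₀) ^ 2) / 2) := by
    rw [abs_mul, abs_mul]
    have h6 : |a| * |B - b₀| ≤ (a ^ 2 + (B - b₀) ^ 2) / 2 := by
      nlinarith [sq_nonneg (|a| - |B - b₀|), sq_abs a, sq_abs (B - b₀)]
    calc |a| * (|B| * |B - b₀|) = |B| * (|a| * |B - b₀|) := by ring
      _ ≤ M * ((a ^ 2 + (B - b₀) ^ 2) / 2) := by gcongr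
  have e : a * (R * n / 2 + R * (R - 1) + B * (B - b₀)) =
      a * (R * n / 2) + a * (R * (R - 1)) + a * (B * (B - b₀)) := by ring
  rw [e]
  refine (abs_add_le _ _).trans ((add_le_add_left (abs_add_le _ _) _).trans ?_)
  have p1 : 0 ≤ (R - 1) ^ 2 := sq_nonneg _
  have p2 : 0 ≤ (B - b₀) ^ 2 := sq_nonneg _
  have : M * a ^ 2 ≤ M * (4 * (R * n / 2)) := by gcongr; linarith
  have p3 := mul_nonneg hb0 p1
  have p4 := mul_nonneg hb0 p2
  have p5 : 0 ≤ R * n := by nlinarith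
  have p6 := mul_nonneg hb0 p5
  nlinarith

/-- Smoothed distance. -/
def NN (x₀ x : E2) : ℝ := √(1 + ((x 0 - x₀ 0) ^ 2 + (x 1 - x₀ 1) ^ 2))

theorem NN_pos (x₀ x : E2) : 0 < NN x₀ x := by unfold NN; positivity

theorem NN_sq (x₀ x : E2) : NN x₀ x ^ 2 = 1 + ((x 0 - x₀ 0) ^ 2 + (x 1 - x₀ 1) ^ 2) := by
  unfold NN; exact Real.sq_sqrt (by positivity)

theorem NN_contDiff (x₀ : E2) : ContDiff ℝ 1 (NN x₀) := by
  unfold NN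
  refine ContDiff.sqrt ?_ (fun x => by positivity)
  fun_prop

theorem norm_le_NN (x₀ x : E2) : ‖x - x₀‖ ≤ NN x₀ x := by
  refine (sq_le_sq₀ (norm_nonneg _) (NN_pos _ _).le).1 ?_
  rw [EuclideanSpace.real_norm_sq_eq, NN_sq, Fin.sum_univ_two]
  simp

theorem NN_pdv (x₀ x : E2) (i : Fin 2) : pdv i (NN x₀) x = (x i - x₀ i) / NN x₀ x := by
  have h : ∀ j : Fin 2, HasFDerivAt (fun x : E2 => x j) (EuclideanSpace.proj j : E2 →L[ℝ] ℝ) x :=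
    fun j => (EuclideanSpace.proj j : E2 →L[ℝ] ℝ).hasFDerivAt
  have h2 := (((((h 0).sub_const (x₀ 0)).pow 2).add (((h 1).sub_const (x₀ 1)).pow 2)).const_add
    1).sqrt (by simp only [Pi.add_apply]; positivity)
  rw [pdv_of (f := NN x₀) h2]
  have h3 := NN_pos x₀ x
  fin_cases i <;> simp [NN] <;> field_simp

/-- The phase. -/
def hh (c r : ℝ) (x₀ : E2) (t : ℝ) (x : E2) : ℝ := r - c * t - NN x₀ x

/-- The weight. -/
def ph (c r : ℝ) (x₀ : E2) (t : ℝ) (x : E2) : ℝ := expNegInvGlue (hh c r x₀ t x)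

theorem ph_contDiff (c r : ℝ) (x₀ : E2) : ContDiff ℝ 1 (fun p : ℝ × E2 => ph c r x₀ p.1 p.2) := by
  unfold ph hh
  have h := NN_contDiff x₀
  refine (expNegInvGlue.contDiff (n := 1)).comp ?_
  fun_prop

theorem ph_contDiff' (c r : ℝ) (x₀ : E2) (t : ℝ) : ContDiff ℝ 1 (ph c r x₀ t) :=
  (ph_contDiff c r x₀).comp (contDiff_const.prodMk contDiff_id)

theorem glue_hasDeriv (y : ℝ) : HasDerivAt expNegInvGlue (deriv expNegInvGlue y) y :=
  ((expNegInvGlue.contDiff (n := 1)).differentiable (by simp) y).hasDerivAt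

theorem glue_deriv_nonneg (y : ℝ) : 0 ≤ deriv expNegInvGlue y := expNegInvGlue.monotone.deriv_nonneg

theorem glue_deriv_zero {y : ℝ} (hy : y ≤ 0) : deriv expNegInvGlue y = 0 := by
  apply IsLocalMin.deriv_eq_zero
  refine Filter.Eventually.of_forall fun z => ?_
  rw [expNegInvGlue.zero_of_nonpos hy]
  exact expNegInvGlue.nonneg z

theorem ph_pdv (c r : ℝ) (x₀ : E2) (t : ℝ) (x : E2) (i : Fin 2) :
    pdv i (ph c r x₀ t) x =
      - (deriv expNegInvGlue (hh c r x₀ t x) * ((x i - x₀ i) / NN x₀ x)) := by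
  have h1 : HasFDerivAt (NN x₀) (fderiv ℝ (NN x₀) x) x :=
    ((NN_contDiff x₀).differentiable one_ne_zero x).hasFDerivAt
  have h2 : HasFDerivAt (hh c r x₀ t) (-fderiv ℝ (NN x₀) x) x := h1.const_sub _
  rw [pdv_of (f := ph c r x₀ t) ((glue_hasDeriv _).comp_hasFDerivAt x h2), ← NN_pdv, pdv]
  simp

theorem ph_dt (c r : ℝ) (x₀ : E2) (t : ℝ) (x : E2) :
    HasDerivAt (fun s => ph c r x₀ s x) (-(c * deriv expNegInvGlue (hh c r x₀ t x))) t := by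
  have h2 : HasDerivAt (fun s => hh c r x₀ s x) (-c) t := by
    have := ((((hasDerivAt_id t).const_mul c).const_sub r).sub_const (NN x₀ x))
    exact this.congr_deriv (by ring)
  have := (glue_hasDeriv (hh c r x₀ t x)).comp t h2
  refine this.congr_deriv (by ring)

variable {b₀ : ℝ}

theorem u_apply_zero {t : ℝ} {x : E2} (h : u t x = 0) (i : Fin 2) : u t x i = 0 := by rw [h]; rfl

theorem qq_hcs (husupp : HasCompactSupport (u t)) (i : Fin 2) :
    HasCompactSupport (qq b₀ ρ u b i t) := by
  refine husupp.mono' ?_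
  intro x hx
  apply subset_tsupport
  intro h
  apply hx
  simp only [qq, u_apply_zero h i, zero_mul]

theorem eta_nonneg {t : ℝ} {x : E2} (h : 0 < ρ t x) : 0 ≤ eta b₀ ρ u b t x := by
  unfold eta; positivity

theorem prop_step (hsol : IsMHDSolution T ρ u b)
    (husupp : ∀ t ∈ timeSet T, HasCompactSupport (u t)) {r : ℝ} {x₀ : E2} {t t' : ℝ}
    (ht : t ∈ timeSet T) (ht' : t' ∈ timeSet T) (htt : t ≤ t')
    (hc : ∀ x, 0 < hh (7 + 2 * |b₀|) r x₀ t x → eta b₀ ρ u b t x = 0)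
    (hn : ∀ s ∈ Icc t t', ∀ x, 0 < hh (7 + 2 * |b₀|) r x₀ s x → 1 / 2 ≤ ρ s x ∧ ρ s x ≤ 2 ∧
      u s x 0 ^ 2 + u s x 1 ^ 2 ≤ 1 ∧ |b s x| ≤ |b₀| + 1) :
    ∀ x, 0 < hh (7 + 2 * |b₀|) r x₀ t' x → eta b₀ ρ u b t' x = 0 := by
  set c := 7 + 2 * |b₀| with hcdef
  have hc0 : 0 ≤ c := by positivity
  set f : ℝ → E2 → ℝ := fun s x => ph c r x₀ s x * eta b₀ ρ u b s x with hf
  have hfc : C1 T f := (ph_contDiff c r x₀).contDiffOn.mul (eta_c1 b₀ hsol)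
  have hz : ∀ s ∈ timeSet T, ∀ x ∉ closedBall x₀ r, f s x = 0 := by
    intro s hs x hx
    have h1 : hh c r x₀ s x ≤ 0 := by
      have := norm_le_NN x₀ x
      rw [mem_closedBall, dist_eq_norm, not_le] at hx
      have := mul_nonneg hc0 hs.1
      unfold hh; linarith
    simp only [hf, ph, expNegInvGlue.zero_of_nonpos h1, zero_mul]
  have hsub : Icc t t' ⊆ timeSet T := fun s hs => timeSet_Icc ht' ⟨ht.1.trans hs.1, hs.2⟩
  have hD : ∀ s ∈ timeSet T,
      HasDerivWithinAt (fun s => ∫ x, f s x) (∫ x, dt T f s x) (timeSet T) s := by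
    intro s hs
    obtain ⟨t₁, h₁, hlt⟩ := timeSet_exists_gt hs
    exact hasDeriv_integral hfc hs h₁ hlt (isCompact_closedBall x₀ r) (fun s hs _ => hz s hs)
  have hneg : ∀ s ∈ Icc t t', ∫ x, dt T f s x ≤ 0 := by
    intro s hs
    have hsT := hsub hs
    have hdt : ∀ x, dt T f s x = -(c * deriv expNegInvGlue (hh c r x₀ s x)) * eta b₀ ρ u b s x
        - (ph c r x₀ s x * pdv 0 (qq b₀ ρ u b 0 s) x + ph c r x₀ s x * pdv 1 (qq b₀ ρ u b 1 s) x) := by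
      intro x
      rw [dt_of hsT ((ph_dt c r x₀ s x).hasDerivWithinAt.mul ((eta_c1 b₀ hsol).hasDeriv hsT x)),
        eta_cons b₀ hsol hsT]
      ring
    have hphc := ph_contDiff' c r x₀ s
    have hqc : ∀ i, ContDiff ℝ 1 (qq b₀ ρ u b i s) := fun i => (qq_c1 b₀ hsol i).contDiff hsT
    have hqs : ∀ i, HasCompactSupport (qq b₀ ρ u b i s) := fun i => qq_hcs (husupp s hsT) i
    have hi1 : ∀ i, Integrable (fun x => ph c r x₀ s x * pdv i (qq b₀ ρ u b i s) x) := fun i =>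
      (hphc.continuous.mul (pdv_continuous (hqc i))).integrable_of_hasCompactSupport
        (pdv_hcs (hqs i)).mul_left
    have hi2 : ∀ i, Integrable (fun x => pdv i (ph c r x₀ s) x * qq b₀ ρ u b i s x) := fun i =>
      ((pdv_continuous hphc).mul (hqc i).continuous).integrable_of_hasCompactSupport
        (hqs i).mul_left
    have hi3 : Integrable (fun x => -(c * deriv expNegInvGlue (hh c r x₀ s x)) * eta b₀ ρ u b s x) := by
      refine Continuous.integrable_of_hasCompactSupport ?_ ?_
      · have h1 : Continuous (deriv expNegInvGlue) :=
          (expNegInvGlue.contDiff (n := 1)).continuous_deriv (by simp)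
        have h2 : Continuous (hh c r x₀ s) := by
          unfold hh; exact continuous_const.sub (NN_contDiff x₀).continuous
        have h3 := ((eta_c1 b₀ hsol).contDiff hsT).continuous
        have h4 : Continuous (fun x => deriv expNegInvGlue (hh c r x₀ s x)) := h1.comp h2
        fun_prop
      · refine HasCompactSupport.intro (isCompact_closedBall x₀ r) fun x hx => ?_
        have h1 : hh c r x₀ s x ≤ 0 := by
          have := norm_le_NN x₀ x
          rw [mem_closedBall, dist_eq_norm, not_le] at hx
          have := mul_nonneg hc0 hsT.1
          unfold hh; linarith
        simp [glue_deriv_zero h1]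
    have hI : ∫ x, dt T f s x = ∫ x, (-(c * deriv expNegInvGlue (hh c r x₀ s x)) * eta b₀ ρ u b s x
        + (pdv 0 (ph c r x₀ s) x * qq b₀ ρ u b 0 s x + pdv 1 (ph c r x₀ s) x * qq b₀ ρ u b 1 s x)) := by
      rw [integral_add hi3 (show Integrable (fun x => _ + _) _ from (hi2 0).add (hi2 1)), integral_add (hi2 0) (hi2 1)]
      simp_rw [hdt]
      rw [integral_sub hi3 (show Integrable (fun x => _ + _) _ from (hi1 0).add (hi1 1)), integral_add (hi1 0) (hi1 1),
        ibp hphc (hqc 0) (hqs 0), ibp hphc (hqc 1) (hqs 1)]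
      ring
    rw [hI]
    refine integral_nonpos fun x => ?_
    simp only [Pi.zero_apply, ph_pdv]
    by_cases hx : 0 < hh c r x₀ s x
    · obtain ⟨n1, n2, n3, n4⟩ := hn s hs x hx
      have hN := NN_pos x₀ x
      have n5 : ((x 0 - x₀ 0) / NN x₀ x) ^ 2 + ((x 1 - x₀ 1) / NN x₀ x) ^ 2 ≤ 1 := by
        rw [div_pow, div_pow, ← add_div, div_le_one (by positivity), NN_sq]
        linarith
      have hq := (abs_le.1 (qbound n1 n2 n3 n4 n5)).1
      have hg := glue_deriv_nonneg (hh c r x₀ s x)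
      have := mul_nonneg hg (sub_nonneg.2 hq)
      unfold eta qq
      linarith
    · simp [glue_deriv_zero (not_lt.1 hx)]
  have hanti : AntitoneOn (fun s => ∫ x, f s x) (Icc t t') := by
    refine antitoneOn_of_deriv_nonpos (convex_Icc _ _) ?_ ?_ ?_
    · exact fun s hs => ((hD s (hsub hs)).mono hsub).continuousWithinAt
    all_goals
      intro s hs
      rw [interior_Icc] at hs
      have hs' : s ∈ Icc t t' := ⟨hs.1.le, hs.2.le⟩
      have := (hD s (hsub hs')).hasDerivAt (timeSet_nhds (hsub hs') (ht.1.trans_lt hs.1))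
    · exact this.differentiableAt.differentiableWithinAt
    · rw [this.deriv]; exact hneg s hs'
  have h0 : ∫ x, f t x = 0 := by
    rw [← integral_zero E2 ℝ (μ := volume)]
    congr 1
    funext x
    by_cases hx : 0 < hh c r x₀ t x
    · simp only [hf, hc x hx, mul_zero]
    · simp only [hf, ph, expNegInvGlue.zero_of_nonpos (not_lt.1 hx), zero_mul]
  have h1 : ∫ x, f t' x ≤ 0 := by
    rw [← h0]; exact hanti ⟨le_rfl, htt⟩ ⟨htt, le_rfl⟩ htt
  have hnn : 0 ≤ f t' := fun x =>
    mul_nonneg (expNegInvGlue.nonneg _) (eta_nonneg (hsol.rho_pos t' ht' x))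
  have hcont : Continuous (f t') := (hfc.contDiff ht').continuous
  have hInt : Integrable (f t') := hcont.integrable_of_hasCompactSupport
    (HasCompactSupport.intro (isCompact_closedBall x₀ r) (hz t' ht'))
  have h2 : ∫ x, f t' x = 0 := le_antisymm h1 (integral_nonneg hnn)
  rw [integral_eq_zero_iff_of_nonneg hnn hInt] at h2
  have h3 := (Continuous.ae_eq_iff_eq volume hcont continuous_const).1 h2
  intro x hx
  have h4 : ph c r x₀ t' x * eta b₀ ρ u b t' x = 0 := congrFun h3 x
  exact (mul_eq_zero.1 h4).resolve_left (expNegInvGlue.pos_of_pos hx).ne'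

theorem eta_zero {t : ℝ} {x : E2} (hr : 0 < ρ t x) (h : eta b₀ ρ u b t x = 0) :
    ρ t x = 1 ∧ u t x 0 = 0 ∧ u t x 1 = 0 ∧ b t x = b₀ := by
  unfold eta at h
  have a1 : 0 ≤ ρ t x * u t x 0 ^ 2 := by positivity
  have a2 : 0 ≤ ρ t x * u t x 1 ^ 2 := by positivity
  have a3 := sq_nonneg (ρ t x - 1)
  have a4 := sq_nonneg (b t x - b₀)
  have e1 : ρ t x * u t x 0 ^ 2 = 0 := by linarith
  have e2 : ρ t x * u t x 1 ^ 2 = 0 := by linarith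
  have e3 : (ρ t x - 1) ^ 2 = 0 := by linarith
  have e4 : (b t x - b₀) ^ 2 = 0 := by linarith
  refine ⟨?_, ?_, ?_, ?_⟩
  · exact sub_eq_zero.1 (pow_eq_zero_iff two_ne_zero |>.1 e3)
  · exact pow_eq_zero_iff two_ne_zero |>.1 ((mul_eq_zero.1 e1).resolve_left hr.ne')
  · exact pow_eq_zero_iff two_ne_zero |>.1 ((mul_eq_zero.1 e2).resolve_left hr.ne')
  · exact sub_eq_zero.1 (pow_eq_zero_iff two_ne_zero |>.1 e4)

theorem hcs_bound {F : Type*} [Zero F] [TopologicalSpace F] {f : E2 → F} (hf : HasCompactSupport f) :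
    ∃ R : ℝ, ∀ x, R < ‖x‖ → f x = 0 := by
  obtain ⟨R, hR⟩ := hf.isCompact.isBounded.subset_closedBall (0 : E2)
  refine ⟨R, fun x hx => ?_⟩
  by_contra h
  have := hR (subset_tsupport f h)
  rw [mem_closedBall, dist_zero_right] at this
  linarith

theorem uniform_support (hsol : IsMHDSolution T ρ u b)
    (hρsupp : ∀ t ∈ timeSet T, HasCompactSupport (fun x => ρ t x - 1))
    (husupp : ∀ t ∈ timeSet T, HasCompactSupport (u t))
    (hbsupp : ∀ t ∈ timeSet T, HasCompactSupport (fun x => b t x - b₀)) {t₁ : ℝ}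
    (ht₁ : t₁ ∈ timeSet T) :
    ∃ K : ℝ, ∀ s ∈ Icc 0 t₁, ∀ x, K < ‖x‖ →
      ρ s x = 1 ∧ u s x 0 = 0 ∧ u s x 1 = 0 ∧ b s x = b₀ := by
  have h0 : (0 : ℝ) ∈ timeSet T := timeSet_Icc ht₁ ⟨le_rfl, ht₁.1⟩
  obtain ⟨R1, hR1⟩ := hcs_bound (hρsupp 0 h0)
  obtain ⟨R2, hR2⟩ := hcs_bound (husupp 0 h0)
  obtain ⟨R3, hR3⟩ := hcs_bound (hbsupp 0 h0)
  have heta0 : ∀ x, max R1 (max R2 R3) < ‖x‖ → eta b₀ ρ u b 0 x = 0 := by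
    intro x hx
    rw [max_lt_iff, max_lt_iff] at hx
    have e1 := hR1 x hx.1
    have e2 := hR2 x hx.2.1
    have e3 := hR3 x hx.2.2
    simp only [eta, e1, e3, u_apply_zero e2]
    ring
  set R0 := max R1 (max R2 R3)
  have hc0 : 0 ≤ 7 + 2 * |b₀| := by positivity
  set r := (7 + 2 * |b₀|) * t₁ + 2 with hr
  refine ⟨R0 + r, fun s hs x₀ hx₀ => ?_⟩
  -- uniform continuity
  have hcont : ContinuousOn (fun p : ℝ × E2 => (ρ p.1 p.2, u p.1 p.2 0, u p.1 p.2 1, b p.1 p.2))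
      (Icc 0 t₁ ×ˢ closedBall x₀ r) := by
    have hsub : Icc 0 t₁ ×ˢ closedBall x₀ r ⊆ timeSet T ×ˢ univ :=
      prod_mono (timeSet_Icc ht₁) (subset_univ _)
    exact (hsol.contDiff_rho.continuousOn.prodMk ((ContDiffOn.continuousOn (hsol.c1u 0)).prodMk
      ((ContDiffOn.continuousOn (hsol.c1u 1)).prodMk hsol.contDiff_b.continuousOn))).mono hsub
  have huc := (isCompact_Icc.prod (isCompact_closedBall x₀ r)).uniformContinuousOn_of_continuous hcont
  rw [Metric.uniformContinuousOn_iff] at huc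
  obtain ⟨δ, hδ, hu⟩ := huc (1 / 2) (by norm_num)
  have hball : ∀ z : ℝ, 0 ≤ z → ∀ x, 0 < hh (7 + 2 * |b₀|) r x₀ z x → ‖x - x₀‖ < r := by
    intro z hz x hx
    have := norm_le_NN x₀ x
    have := mul_nonneg hc0 hz
    unfold hh at hx
    linarith
  have hstep : ∀ t ∈ Icc 0 t₁, ∀ t' ∈ Icc 0 t₁, t ≤ t' → t' ≤ t + δ / 2 →
      (∀ x, 0 < hh (7 + 2 * |b₀|) r x₀ t x → eta b₀ ρ u b t x = 0) →
      (∀ x, 0 < hh (7 + 2 * |b₀|) r x₀ t' x → eta b₀ ρ u b t' x = 0) := by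
    intro t ht t' ht' htt hd hP
    have htT := timeSet_Icc ht₁ ht
    refine prop_step hsol husupp htT (timeSet_Icc ht₁ ht') htt hP ?_
    intro z hz x hx
    have hzI : z ∈ Icc 0 t₁ := ⟨ht.1.trans hz.1, hz.2.trans ht'.2⟩
    have hxb : x ∈ closedBall x₀ r := by
      rw [mem_closedBall, dist_eq_norm]; exact (hball z hzI.1 x hx).le
    have hx' : 0 < hh (7 + 2 * |b₀|) r x₀ t x := by
      have := mul_le_mul_of_nonneg_left hz.1 hc0
      unfold hh at hx ⊢; linarith
    obtain ⟨c1, c2, c3, c4⟩ := eta_zero (hsol.rho_pos t htT x) (hP x hx')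
    have hdist := hu (z, x) ⟨hzI, hxb⟩ (t, x) ⟨ht, hxb⟩ (by
      rw [Prod.dist_eq, dist_self, Real.dist_eq, abs_of_nonneg (by linarith [hz.1])]
      refine max_lt ?_ hδ
      linarith [hz.2])
    simp only [Prod.dist_eq, max_lt_iff, Real.dist_eq, c1, c2, c3, c4, sub_zero] at hdist
    obtain ⟨d1, d2, d3, d4⟩ := hdist
    rw [abs_lt] at d1 d2 d3
    refine ⟨by linarith, by linarith, by nlinarith, ?_⟩
    have := abs_sub_abs_le_abs_sub (b z x) b₀
    linarith
  have hall : ∀ n : ℕ, ∀ t ∈ Icc 0 t₁, t ≤ n * (δ / 2) →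
      ∀ x, 0 < hh (7 + 2 * |b₀|) r x₀ t x → eta b₀ ρ u b t x = 0 := by
    intro n
    induction n with
    | zero =>
      intro t ht htn x hx
      have : t = 0 := le_antisymm (by simpa using htn) ht.1
      subst this
      apply heta0
      have h1 := hball 0 le_rfl x hx
      have h2 := norm_sub_norm_le x₀ x
      rw [norm_sub_rev] at h2
      linarith
    | succ n ih =>
      intro t ht htn
      push_cast at htn
      have hm : max 0 (t - δ / 2) ∈ Icc 0 t₁ := ⟨le_max_left _ _, max_le ht₁.1 (by linarith [ht.2])⟩
      refine hstep _ hm t ht (max_le ht.1 (by linarith)) ?_ (ih _ hm ?_)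
      · linarith [le_max_right 0 (t - δ / 2)]
      · exact max_le (by positivity) (by linarith)
  obtain ⟨n, hn⟩ := exists_nat_ge (s / (δ / 2))
  refine eta_zero (hsol.rho_pos s (timeSet_Icc ht₁ hs) x₀) (hall n s hs ?_ x₀ ?_)
  · rwa [div_le_iff₀ (by positivity)] at hn
  · have := mul_le_mul_of_nonneg_left hs.2 hc0
    simp only [hh, NN, sub_self]
    norm_num
    linarith

end PW

theorem sph_coord (ω : sphere (0 : E2) 1) : (ω : E2) 0 * (ω : E2) 0 + (ω : E2) 1 * (ω : E2) 1 = 1 := by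
  have h1 : ‖(ω : E2)‖ ^ 2 = 1 := by simp
  rw [EuclideanSpace.real_norm_sq_eq, Fin.sum_univ_two] at h1
  linarith

theorem inner_coord (v w : E2) : ⟪v, w⟫ = v 0 * w 0 + v 1 * w 1 := by
  simp [PiLp.inner_apply, Fin.sum_univ_two, mul_comm]

/-- Coordinate weights. -/
def VV (j : Fin 2) : E2 → ℝ := G (fun ω => (ω : E2) j)

/-- Second order coordinate weights. -/
def WW (i j : Fin 2) : E2 → ℝ := G (fun ω => (ω : E2) j * (ω : E2) i)

theorem coord_cont (j : Fin 2) : Continuous (fun ω : sphere (0 : E2) 1 => (ω : E2) j) := by fun_prop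

theorem VV_contDiff (j : Fin 2) : ContDiff ℝ 1 (VV j) := G_contDiff (coord_cont j)

theorem VV_pdv (i j : Fin 2) (x : E2) : pdv i (VV j) x = WW i j x := G_pdv (coord_cont j) i x

theorem inner_int1 (R : ℝ) (v x : E2) :
    ∫ ω : sphere (0 : E2) 1, exp ⟪(ω : E2), x⟫ * (R * ⟪v, (ω : E2)⟫) ∂sphμ =
      VV 0 x * (R * v 0) + VV 1 x * (R * v 1) := by
  simp only [VV, G]
  rw [← integral_mul_const, ← integral_mul_const, ← integral_add]
  · congr 1; funext ω; rw [inner_coord v]; ring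
  all_goals exact sph_integrable (by fun_prop)

theorem inner_int2 (R : ℝ) (v x : E2) :
    ∫ ω : sphere (0 : E2) 1, exp ⟪(ω : E2), x⟫ * (R * ⟪v, (ω : E2)⟫ ^ 2) ∂sphμ =
      (WW 0 0 x * (R * v 0 * v 0) + WW 1 0 x * (R * v 1 * v 0)) +
      (WW 0 1 x * (R * v 0 * v 1) + WW 1 1 x * (R * v 1 * v 1)) := by
  simp only [WW, G]
  simp only [← integral_mul_const]
  rw [← integral_add, ← integral_add, ← integral_add]
  · congr 1; funext ω; rw [inner_coord v]; ring
  all_goals exact sph_integrable (by fun_prop)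

theorem inner_int3 (P : ℝ) (x : E2) :
    ∫ ω : sphere (0 : E2) 1, exp ⟪(ω : E2), x⟫ * P ∂sphμ =
      WW 0 0 x * P + WW 1 1 x * P := by
  simp only [WW, G]
  simp only [← integral_mul_const]
  rw [← integral_add]
  · congr 1; funext ω
    linear_combination (-exp ⟪(ω : E2), x⟫ * P) * sph_coord ω
  all_goals exact sph_integrable (by fun_prop)

/-- For a classical solution of the 2D MHD system with `ρ(t,·) − 1`, `u(t,·)`, `b(t,·) − b₀`
compactly supported, `Y(t) = ∫∫ e^{ω·x} ρ (u·ω) dσ dx` is differentiable with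
`Y'(t) = ∫∫ e^{ω·x} ρ (u·ω)² + ½ ∫∫ e^{ω·x}(b² + ρ² − b₀² − 1)`. -/
theorem mhd_Y_deriv
    (T : ℝ≥0∞) (ρ : ℝ → E2 → ℝ) (u : ℝ → E2 → E2) (b : ℝ → E2 → ℝ) (b₀ : ℝ)
    (hsol : IsMHDSolution T ρ u b)
    (hρsupp : ∀ t ∈ timeSet T, HasCompactSupport (fun x => ρ t x - 1))
    (husupp : ∀ t ∈ timeSet T, HasCompactSupport (u t))
    (hbsupp : ∀ t ∈ timeSet T, HasCompactSupport (fun x => b t x - b₀)) :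
    ∀ t ∈ timeSet T,
      HasDerivWithinAt
        (fun s => ∫ x : E2, ∫ ω : sphere (0 : E2) 1,
          exp ⟪(ω : E2), x⟫ * (ρ s x * ⟪u s x, (ω : E2)⟫) ∂sphμ)
        ((∫ x : E2, ∫ ω : sphere (0 : E2) 1,
            exp ⟪(ω : E2), x⟫ * (ρ t x * ⟪u t x, (ω : E2)⟫ ^ 2) ∂sphμ)
          + (1 / 2) * ∫ x : E2, ∫ ω : sphere (0 : E2) 1,
              exp ⟪(ω : E2), x⟫ * (b t x ^ 2 + ρ t x ^ 2 - b₀ ^ 2 - 1) ∂sphμ)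
        (timeSet T) t := by
  intro t ht
  obtain ⟨t₁, ht₁, hlt⟩ := timeSet_exists_gt ht
  obtain ⟨K, hK⟩ := uniform_support hsol hρsupp husupp hbsupp ht₁
  have cr : C1 T ρ := hsol.contDiff_rho
  have cb : C1 T b := hsol.contDiff_b
  have cm : ∀ j, C1 T (fun s x => ρ s x * u s x j) := fun j => ContDiffOn.mul cr (hsol.c1u j)
  have hV : ∀ j, C1 T (fun _ x => VV j x) := fun j =>
    ((VV_contDiff j).comp contDiff_snd).contDiffOn
  set f : ℝ → E2 → ℝ := fun s x => VV 0 x * (ρ s x * u s x 0) + VV 1 x * (ρ s x * u s x 1) with hf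
  have hfc : C1 T f := ContDiffOn.add (ContDiffOn.mul (hV 0) (cm 0)) (ContDiffOn.mul (hV 1) (cm 1))
  have hD := hasDeriv_integral hfc ht ht₁ hlt (isCompact_closedBall (0 : E2) K) (by
    intro s hs hs1 x hx
    rw [mem_closedBall, dist_zero_right, not_le] at hx
    obtain ⟨_, h0, h1, _⟩ := hK s ⟨hs.1, hs1⟩ x hx
    simp [hf, h0, h1])
  simp only [inner_int1, inner_int2, inner_int3]
  refine hD.congr_deriv ?_
  -- spatial quantities at time `t`
  have kr : ContDiff ℝ 1 (ρ t) := cr.contDiff ht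
  have kb : ContDiff ℝ 1 (b t) := cb.contDiff ht
  have ku : ∀ i, ContDiff ℝ 1 (fun x => u t x i) := fun i => (hsol.c1u i).contDiff ht
  set g : Fin 2 → Fin 2 → E2 → ℝ := fun i j x => ρ t x * u t x i * u t x j with hg
  set P : E2 → ℝ := fun x => (b t x ^ 2 + ρ t x ^ 2 - b₀ ^ 2 - 1) / 2 with hP
  have gc : ∀ i j, ContDiff ℝ 1 (g i j) := fun i j => (kr.mul (ku i)).mul (ku j)
  have Pc : ContDiff ℝ 1 P := by
    simp only [hP]; fun_prop
  have gs : ∀ i j, HasCompactSupport (g i j) := by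
    intro i j
    refine HasCompactSupport.intro (isCompact_closedBall (0 : E2) K) fun x hx => ?_
    rw [mem_closedBall, dist_zero_right, not_le] at hx
    obtain ⟨_, h0, h1, _⟩ := hK t ⟨ht.1, hlt.le⟩ x hx
    fin_cases j <;> simp [hg, h0, h1]
  have Ps : HasCompactSupport P := by
    refine HasCompactSupport.intro (isCompact_closedBall (0 : E2) K) fun x hx => ?_
    rw [mem_closedBall, dist_zero_right, not_le] at hx
    obtain ⟨h0, _, _, h1⟩ := hK t ⟨ht.1, hlt.le⟩ x hx
    simp [hP, h0, h1]
  have hmom : ∀ j x, dt T (fun s x => ρ s x * u s x j) t x =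
      -(pdv 0 (g 0 j) x + pdv 1 (g 1 j) x + pdv j P x) := by
    intro j x
    have h := hsol.momentum t ht x j
    rw [Fin.sum_univ_two] at h
    have h2 : pdv j P x = pdv j (fun y => (ρ t y ^ 2 + b t y ^ 2) / 2) x := by
      have : P = fun y => (ρ t y ^ 2 + b t y ^ 2) / 2 - (b₀ ^ 2 + 1) / 2 := by
        funext y; simp only [hP]; ring
      rw [this, pdv, pdv, fderiv_sub_const]
    rw [h2]
    change dt T (fun s x => ρ s x * u s x j) t x + (pdv 0 (g 0 j) x + pdv 1 (g 1 j) x) + _ = 0 at h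
    linarith
  have hdt : ∀ x, dt T f t x =
      -((VV 0 x * pdv 0 (g 0 0) x + VV 0 x * pdv 1 (g 1 0) x + VV 0 x * pdv 0 P x) +
        (VV 1 x * pdv 0 (g 0 1) x + VV 1 x * pdv 1 (g 1 1) x + VV 1 x * pdv 1 P x)) := by
    intro x
    have h : dt T f t x = _ := dt_of ht ((((cm 0).hasDeriv ht x).const_mul (VV 0 x)).add
      (((cm 1).hasDeriv ht x).const_mul (VV 1 x)))
    rw [h, hmom, hmom]; ring
  have I1 : ∀ (j i : Fin 2) (F : E2 → ℝ), ContDiff ℝ 1 F → HasCompactSupport F →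
      Integrable (fun x => VV j x * pdv i F x) := fun j i F hF hs =>
    ((VV_contDiff j).continuous.mul (pdv_continuous hF)).integrable_of_hasCompactSupport
      (pdv_hcs hs).mul_left
  have I2 : ∀ (j i : Fin 2) (F : E2 → ℝ), ContDiff ℝ 1 F → HasCompactSupport F →
      Integrable (fun x => WW i j x * F x) := fun j i F hF hs => by
    have := ((pdv_continuous (i := i) (VV_contDiff j)).mul hF.continuous).integrable_of_hasCompactSupport
      (μ := volume) hs.mul_left
    have e : pdv i (VV j) = WW i j := funext fun x => VV_pdv i j x
    rw [e] at this
    exact this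
  have IB : ∀ (j i : Fin 2) (F : E2 → ℝ), ContDiff ℝ 1 F → HasCompactSupport F →
      ∫ x, VV j x * pdv i F x = - ∫ x, WW i j x * F x := fun j i F hF hs => by
    rw [ibp (VV_contDiff j) hF hs]; simp only [VV_pdv]
  have L : ∫ x, dt T f t x = ((∫ x, WW 0 0 x * g 0 0 x) + (∫ x, WW 1 0 x * g 1 0 x) + ∫ x, WW 0 0 x * P x)
      + ((∫ x, WW 0 1 x * g 0 1 x) + (∫ x, WW 1 1 x * g 1 1 x) + ∫ x, WW 1 1 x * P x) := by
    simp only [hdt]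
    have j1 := I1 0 0 _ (gc 0 0) (gs 0 0)
    have j2 := I1 0 1 _ (gc 1 0) (gs 1 0)
    have j3 := I1 0 0 _ Pc Ps
    have j4 := I1 1 0 _ (gc 0 1) (gs 0 1)
    have j5 := I1 1 1 _ (gc 1 1) (gs 1 1)
    have j6 := I1 1 1 _ Pc Ps
    have j12 : Integrable (fun x => VV 0 x * pdv 0 (g 0 0) x + VV 0 x * pdv 1 (g 1 0) x) := j1.add j2
    have j45 : Integrable (fun x => VV 1 x * pdv 0 (g 0 1) x + VV 1 x * pdv 1 (g 1 1) x) := j4.add j5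
    have j123 : Integrable (fun x => VV 0 x * pdv 0 (g 0 0) x + VV 0 x * pdv 1 (g 1 0) x
      + VV 0 x * pdv 0 P x) := j12.add j3
    have j456 : Integrable (fun x => VV 1 x * pdv 0 (g 0 1) x + VV 1 x * pdv 1 (g 1 1) x
      + VV 1 x * pdv 1 P x) := j45.add j6
    rw [integral_neg, integral_add j123 j456, integral_add j12 j3, integral_add j45 j6,
      integral_add j1 j2, integral_add j4 j5, IB 0 0 _ (gc 0 0) (gs 0 0), IB 0 1 _ (gc 1 0) (gs 1 0),
      IB 0 0 _ Pc Ps, IB 1 0 _ (gc 0 1) (gs 0 1), IB 1 1 _ (gc 1 1) (gs 1 1), IB 1 1 _ Pc Ps]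
    ring
  have k1 := I2 0 0 _ (gc 0 0) (gs 0 0)
  have k2 := I2 0 1 _ (gc 1 0) (gs 1 0)
  have k3 := I2 0 0 _ Pc Ps
  have k4 := I2 1 0 _ (gc 0 1) (gs 0 1)
  have k5 := I2 1 1 _ (gc 1 1) (gs 1 1)
  have k6 := I2 1 1 _ Pc Ps
  have k12 : Integrable (fun x => WW 0 0 x * g 0 0 x + WW 1 0 x * g 1 0 x) := k1.add k2
  have k45 : Integrable (fun x => WW 0 1 x * g 0 1 x + WW 1 1 x * g 1 1 x) := k4.add k5
  have R1 : ∫ x, ((WW 0 0 x * g 0 0 x + WW 1 0 x * g 1 0 x) + (WW 0 1 x * g 0 1 x + WW 1 1 x * g 1 1 x))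
      = ((∫ x, WW 0 0 x * g 0 0 x) + (∫ x, WW 1 0 x * g 1 0 x)) +
        ((∫ x, WW 0 1 x * g 0 1 x) + (∫ x, WW 1 1 x * g 1 1 x)) := by
    rw [integral_add k12 k45, integral_add k1 k2, integral_add k4 k5]
  have R2 : (1 / 2) * ∫ x, (WW 0 0 x * (b t x ^ 2 + ρ t x ^ 2 - b₀ ^ 2 - 1)
      + WW 1 1 x * (b t x ^ 2 + ρ t x ^ 2 - b₀ ^ 2 - 1)) =
      (∫ x, WW 0 0 x * P x) + ∫ x, WW 1 1 x * P x := by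
    rw [← integral_add k3 k6, ← integral_const_mul]
    congr 1; funext x; simp only [hP]; ring
  rw [L, R2]
  change _ = (∫ x, ((WW 0 0 x * g 0 0 x + WW 1 0 x * g 1 0 x) +
    (WW 0 1 x * g 0 1 x + WW 1 1 x * g 1 1 x))) + _
  rw [R1]
  ring

end
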